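/- arXiv:math/0602126 — 4 statements merged into one kernel-verified Lean document; each statement's English description precedes it below -/
import Mathlib

section
/- The class K₀ has the amalgamation property: for all A, B₁, B₂ in K₀ with embeddings f₁ : A → B₁ and f₂ : A → B₂, there exist C in K₀ and embeddings g₁ : B₁ → C and g₂ : B₂ → C with g₁ ∘ f₁ = g₂ ∘ f₂. -/
open FirstOrder FirstOrder.Language

/-- The relation symbols of the language `L₀`: for each `n ≥ 3`,
a symbol `Eₙ` of arity `2 * n`. -/
inductive L0Rel : ℕ → Type
  | E (n : ℕ) (hn : 3 ≤ n) : L0Rel (2 * n)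

/-- The language `L₀`, with one relation symbol `Eₙ` of arity `2n` for each `n ≥ 3`,
and no function symbols. -/
def L0 : FirstOrder.Language :=
  { Functions := fun _ => Empty
    Relations := L0Rel }

/-- The interpretation of `Eₙ` as a binary relation on `n`-tuples:
`ERel n hn x y` holds iff `Eₙ(x̄, ȳ)` holds of the concatenated `2n`-tuple. -/
def ERel {M : Type*} [L0.Structure M] (n : ℕ) (hn : 3 ≤ n) (x y : Fin n → M) : Prop :=
  Structure.RelMap (L := L0) (L0Rel.E n hn) (Fin.append x y ∘ Fin.cast (two_mul n))

/-- Membership in the class `K₀`: a finite `L₀`-structure in which,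
for each `n ≥ 3`, `Eₙ` holds only on `2n`-tuples whose halves each consist of `n`
pairwise distinct elements, is invariant under separately permuting the entries of the
two halves, induces an equivalence relation on the `n`-element subsets
(reflexivity on injective tuples, symmetry and transitivity), and is empty when
`n` exceeds the cardinality of the structure. -/
def MemK0 (A : Type*) [L0.Structure A] : Prop :=
  Finite A ∧ ∀ (n : ℕ) (hn : 3 ≤ n),
    (∀ x y : Fin n → A, ERel n hn x y → Function.Injective x ∧ Function.Injective y) ∧
    (∀ (x y : Fin n → A) (σ τ : Equiv.Perm (Fin n)),
      ERel n hn x y → ERel n hn (x ∘ σ) (y ∘ τ)) ∧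
    (∀ x : Fin n → A, Function.Injective x → ERel n hn x x) ∧
    (∀ x y : Fin n → A, ERel n hn x y → ERel n hn y x) ∧
    (∀ x y z : Fin n → A, ERel n hn x y → ERel n hn y z → ERel n hn x z) ∧
    (n > Nat.card A → ∀ x y : Fin n → A, ¬ ERel n hn x y)

/-- The first half of a `2n`-tuple. -/
def leftHalf {M : Type*} {n : ℕ} (z : Fin (2 * n) → M) : Fin n → M :=
  fun i => z (Fin.cast (two_mul n).symm (Fin.castAdd n i))

/-- The second half of a `2n`-tuple. -/
def rightHalf {M : Type*} {n : ℕ} (z : Fin (2 * n) → M) : Fin n → M :=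
  fun i => z (Fin.cast (two_mul n).symm (Fin.natAdd n i))

theorem append_leftHalf_rightHalf {M : Type*} {n : ℕ} (z : Fin (2 * n) → M) :
    Fin.append (leftHalf z) (rightHalf z) ∘ Fin.cast (two_mul n) = z := by
  funext i
  obtain ⟨j, rfl⟩ : ∃ j, i = Fin.cast (two_mul n).symm j := ⟨Fin.cast (two_mul n) i, rfl⟩
  refine Fin.addCases (fun k => ?_) (fun k => ?_) j 
  · simp [leftHalf]
  · simp [rightHalf, -Fin.natAdd_eq_addNat]

theorem leftHalf_append {M : Type*} {n : ℕ} (x y : Fin n → M) :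
    leftHalf (Fin.append x y ∘ Fin.cast (two_mul n)) = x := by
  funext i
  simp [leftHalf]

theorem rightHalf_append {M : Type*} {n : ℕ} (x y : Fin n → M) :
    rightHalf (Fin.append x y ∘ Fin.cast (two_mul n)) = y := by
  funext i
  simp [rightHalf, -Fin.natAdd_eq_addNat]

/-- The `L₀`-structure on `M` in which `Eₙ` is interpreted by `R n`. -/
@[reducible] def structureOfRel {M : Type*} (R : ∀ n, (Fin n → M) → (Fin n → M) → Prop) :
    L0.Structure M where
  funMap := fun f => nomatch f
  RelMap := fun r z => match r, z with
    | L0Rel.E n _, z => R n (leftHalf z) (rightHalf z)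

theorem eRel_structureOfRel {M : Type*} (R : ∀ n, (Fin n → M) → (Fin n → M) → Prop)
    (n : ℕ) (hn : 3 ≤ n) (x y : Fin n → M) :
    @ERel M (structureOfRel R) n hn x y ↔ R n x y := by
  change R n (leftHalf _) (rightHalf _) ↔ _
  rw [leftHalf_append, rightHalf_append]

theorem append_comp_cast {M N : Type*} (f : M → N) {n : ℕ} (x y : Fin n → M) :
    Fin.append (f ∘ x) (f ∘ y) ∘ Fin.cast (two_mul n) =
      f ∘ (Fin.append x y ∘ Fin.cast (two_mul n)) := by
  rw [← append_leftHalf_rightHalf (f ∘ (Fin.append x y ∘ Fin.cast (two_mul n)))]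
  congr 2
  · exact congrArg (f ∘ ·) (leftHalf_append x y).symm
  · exact congrArg (f ∘ ·) (rightHalf_append x y).symm

theorem eRel_embedding {M N : Type*} [L0.Structure M] [L0.Structure N] (f : M ↪[L0] N)
    (n : ℕ) (hn : 3 ≤ n) (x y : Fin n → M) :
    ERel n hn (f ∘ x) (f ∘ y) ↔ ERel n hn x y := by
  unfold ERel
  rw [append_comp_cast]
  exact f.map_rel _ _

/-- An injective map preserving and reflecting every `Eₙ` is an embedding. -/
def embeddingOfERel {M N : Type*} [L0.Structure M] [L0.Structure N] (f : M → N)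
    (hf : Function.Injective f)
    (h : ∀ n hn (x y : Fin n → M), ERel n hn (f ∘ x) (f ∘ y) ↔ ERel n hn x y) :
    M ↪[L0] N where
  toFun := f
  inj' := hf
  map_fun' := fun g => nomatch g
  map_rel' := fun r z => by
    cases r with
    | E n hn =>
      have := h n hn (leftHalf z) (rightHalf z)
      unfold ERel at this
      rwa [append_comp_cast, append_leftHalf_rightHalf] at this

/-- The amalgam of two partial equivalence relations `R` and `S` over an equivalence
relation `P`. -/
def AmalgRel {X : Type*} (P R S : X → X → Prop) (x y : X) : Prop :=
  P x y ∨ R x y ∨ S x y ∨ (∃ z, R x z ∧ S z y) ∨ ∃ z, S x z ∧ R z y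

theorem AmalgRel.symm {X : Type*} {P R S : X → X → Prop}
    (hP : ∀ x y, P x y → P y x) (hR : ∀ x y, R x y → R y x) (hS : ∀ x y, S x y → S y x)
    {x y : X} (h : AmalgRel P R S x y) : AmalgRel P R S y x := by
  unfold AmalgRel at *
  grind

/-- The relations `R` and `S` agree where both are defined, so two consecutive changes between
them collapse. -/
theorem AmalgRel.trans {X : Type*} {P R S : X → X → Prop}
    (hP : ∀ x y, P x y → P y x) (hR : ∀ x y, R x y → R y x) (hS : ∀ x y, S x y → S y x)
    (tP : ∀ x y z, P x y → P y z → P x z)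
    (tR : ∀ x y z, R x y → R y z → R x z) (tS : ∀ x y z, S x y → S y z → S x z)
    (pR : ∀ x y z, P x y → R y z → R x z) (pS : ∀ x y z, P x y → S y z → S x z)
    (RS : ∀ x y, R x x → R y y → S x y → R x y) (SR : ∀ x y, S x x → S y y → R x y → S x y)
    {x y z : X} (h : AmalgRel P R S x y) (h' : AmalgRel P R S y z) : AmalgRel P R S x z := by
  have rP : ∀ x y z, R x y → P y z → R x z := fun x y z h h' =>
    hR _ _ (pR _ _ _ (hP _ _ h') (hR _ _ h))
  have sP : ∀ x y z, S x y → P y z → S x z := fun x y z h h' =>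
    hS _ _ (pS _ _ _ (hP _ _ h') (hS _ _ h))
  have rsr : ∀ x y z w, R x y → S y z → R z w → R x w := fun x y z w h₁ h₂ h₃ =>
    tR _ _ _ h₁ (tR _ _ _
      (RS _ _ (tR _ _ _ (hR _ _ h₁) h₁) (tR _ _ _ h₃ (hR _ _ h₃)) h₂) h₃)
  have srs : ∀ x y z w, S x y → R y z → S z w → S x w := fun x y z w h₁ h₂ h₃ =>
    tS _ _ _ h₁ (tS _ _ _
      (SR _ _ (tS _ _ _ (hS _ _ h₁) h₁) (tS _ _ _ h₃ (hS _ _ h₃)) h₂) h₃)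
  unfold AmalgRel at *
  rcases h with h | h | h | ⟨u, h, k⟩ | ⟨u, h, k⟩ <;>
    rcases h' with h' | h' | h' | ⟨v, h', k'⟩ | ⟨v, h', k'⟩ <;> grind

theorem AmalgRel.left {X : Type*} {P R S : X → X → Prop}
    (hR : ∀ x y, R x y → R y x)
    (tR : ∀ x y z, R x y → R y z → R x z)
    (pR : ∀ x y z, P x y → R y z → R x z)
    (RS : ∀ x y, R x x → R y y → S x y → R x y)
    {x y : X} (hx : R x x) (hy : R y y) (h : AmalgRel P R S x y) : R x y := by
  rcases h with h | h | h | ⟨u, h, k⟩ | ⟨u, h, k⟩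
  · exact pR _ _ _ h hy
  · exact h
  · exact RS _ _ hx hy h
  · exact tR _ _ _ h (RS _ _ (tR _ _ _ (hR _ _ h) h) hy k)
  · exact tR _ _ _ (RS _ _ hx (tR _ _ _ k (hR _ _ k)) h) k

theorem AmalgRel.swap {X : Type*} {P R S : X → X → Prop} {x y : X}
    (h : AmalgRel P R S x y) : AmalgRel P S R x y := by
  rcases h with h | h | h | h | h
  exacts [Or.inl h, Or.inr (Or.inr (Or.inl h)), Or.inr (Or.inl h),
    Or.inr (Or.inr (Or.inr (Or.inr h))), Or.inr (Or.inr (Or.inr (Or.inl h)))]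

/-- Two injections out of a set can be amalgamated with the two images meeting exactly in the
image of that set. -/
theorem exists_strong_amalgam {A B₁ B₂ : Type} [Finite B₁] [Finite B₂]
    (f₁ : A → B₁) (f₂ : A → B₂) (h₁ : Function.Injective f₁) (h₂ : Function.Injective f₂) :
    ∃ (C : Type) (g₁ : B₁ → C) (g₂ : B₂ → C), Finite C ∧ Function.Injective g₁ ∧
      Function.Injective g₂ ∧ (∀ a, g₁ (f₁ a) = g₂ (f₂ a)) ∧
      ∀ b₁ b₂, g₁ b₁ = g₂ b₂ → ∃ a, f₁ a = b₁ ∧ f₂ a = b₂ := by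
  classical
  let g₂ : B₂ → B₁ ⊕ {b : B₂ // ¬ ∃ a, f₂ a = b} := fun b =>
    if h : ∃ a, f₂ a = b then Sum.inl (f₁ h.choose) else Sum.inr ⟨b, h⟩
  have hg : ∀ a, g₂ (f₂ a) = Sum.inl (f₁ a) := fun a => by
    have h : ∃ a', f₂ a' = f₂ a := ⟨a, rfl⟩
    simp only [g₂, dif_pos h]
    rw [h₂ h.choose_spec]
  have hg' : ∀ b (h : ¬ ∃ a, f₂ a = b), g₂ b = Sum.inr ⟨b, h⟩ := fun b h => dif_neg h
  refine ⟨_, Sum.inl, g₂, inferInstance, Sum.inl_injective, ?_, fun a => (hg a).symm, ?_⟩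
  · intro b c hbc
    by_cases hb : ∃ a, f₂ a = b <;> by_cases hc : ∃ a, f₂ a = c
    · obtain ⟨a, rfl⟩ := hb
      obtain ⟨a', rfl⟩ := hc
      rw [hg, hg] at hbc
      rw [h₁ (Sum.inl_injective hbc)]
    · obtain ⟨a, rfl⟩ := hb
      rw [hg, hg' c hc] at hbc
      cases hbc
    · obtain ⟨a, rfl⟩ := hc
      rw [hg, hg' b hb] at hbc
      cases hbc
    · rw [hg' b hb, hg' c hc] at hbc
      exact congrArg Subtype.val (Sum.inr_injective hbc)
  · intro b₁ b₂ h
    by_cases hb : ∃ a, f₂ a = b₂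
    · obtain ⟨a, rfl⟩ := hb
      rw [hg] at h
      exact ⟨a, (Sum.inl_injective h).symm, rfl⟩
    · rw [hg' b₂ hb] at h
      cases h

/-- The pushforward of `Eₙ` along a map `g`. -/
def PushRel {B C : Type*} [L0.Structure B] (g : B → C) (n : ℕ) (x y : Fin n → C) : Prop :=
  ∃ (hn : 3 ≤ n) (u v : Fin n → B), g ∘ u = x ∧ g ∘ v = y ∧ ERel n hn u v

/-- Two tuples are rearrangements of each other. -/
def PermRel {C : Type*} {n : ℕ} (x y : Fin n → C) : Prop :=
  ∃ σ : Equiv.Perm (Fin n), y = x ∘ σ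

theorem PermRel.symm {C : Type*} {n : ℕ} (x y : Fin n → C) (h : PermRel x y) : PermRel y x := by
  obtain ⟨σ, rfl⟩ := h
  exact ⟨σ⁻¹, by funext i; simp⟩

theorem PermRel.trans {C : Type*} {n : ℕ} (x y z : Fin n → C) (h : PermRel x y)
    (h' : PermRel y z) : PermRel x z := by
  obtain ⟨σ, rfl⟩ := h
  obtain ⟨τ, rfl⟩ := h'
  exact ⟨σ * τ, rfl⟩

section PushRel

variable {B C : Type*} [L0.Structure B] {g : B → C}

theorem pushRel_comp (hg : Function.Injective g) {n : ℕ} (hn : 3 ≤ n) (u v : Fin n → B) :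
    PushRel g n (g ∘ u) (g ∘ v) ↔ ERel n hn u v := by
  constructor
  · rintro ⟨_, u', v', hu, hv, h⟩
    rwa [hg.comp_left hu, hg.comp_left hv] at h
  · exact fun h => ⟨hn, u, v, rfl, rfl, h⟩

theorem PushRel.symm (hB : MemK0 B) {n : ℕ} (x y : Fin n → C) (h : PushRel g n x y) :
    PushRel g n y x := by
  obtain ⟨hn, u, v, hu, hv, h⟩ := h
  exact ⟨hn, v, u, hv, hu, (hB.2 n hn).2.2.2.1 _ _ h⟩

theorem PushRel.trans (hB : MemK0 B) (hg : Function.Injective g) {n : ℕ} (x y z : Fin n → C)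
    (h : PushRel g n x y) (h' : PushRel g n y z) : PushRel g n x z := by
  obtain ⟨hn, u, v, hu, rfl, h⟩ := h
  obtain ⟨_, v', w, hv', hw, h'⟩ := h'
  obtain rfl := hg.comp_left hv'
  exact ⟨hn, u, w, hu, hw, (hB.2 n hn).2.2.2.2.1 _ _ _ h h'⟩

theorem PushRel.permRel_left (hB : MemK0 B) {n : ℕ} (x y z : Fin n → C)
    (h : PermRel x y) (h' : PushRel g n y z) : PushRel g n x z := by
  obtain ⟨σ, rfl⟩ := h.symm
  obtain ⟨hn, u, v, rfl, hv, h'⟩ := h'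
  exact ⟨hn, u ∘ σ, v, rfl, hv, (hB.2 n hn).2.1 u v σ 1 h'⟩

end PushRel

/-- Pushforwards along the two legs of a strong amalgam agree on tuples in both images. -/
theorem PushRel.of_pushRel {A B₁ B₂ C : Type*} [L0.Structure A] [L0.Structure B₁]
    [L0.Structure B₂] (f₁ : A ↪[L0] B₁) (f₂ : A ↪[L0] B₂) {g₁ : B₁ → C} {g₂ : B₂ → C}
    (hg : ∀ b₁ b₂, g₁ b₁ = g₂ b₂ → ∃ a, f₁ a = b₁ ∧ f₂ a = b₂) {n : ℕ} (x y : Fin n → C)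
    (hx : PushRel g₁ n x x) (hy : PushRel g₁ n y y) (h : PushRel g₂ n x y) :
    PushRel g₁ n x y := by
  obtain ⟨-, u, -, rfl, -⟩ := hx
  obtain ⟨-, v, -, rfl, -⟩ := hy
  obtain ⟨hn, u', v', hu, hv, h⟩ := h
  choose a ha₁ ha₂ using fun i => hg (u i) (u' i) (congrFun hu i).symm
  choose b hb₁ hb₂ using fun i => hg (v i) (v' i) (congrFun hv i).symm
  obtain rfl : f₁ ∘ a = u := funext ha₁
  obtain rfl : f₁ ∘ b = v := funext hb₁
  obtain rfl : f₂ ∘ a = u' := funext ha₂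
  obtain rfl : f₂ ∘ b = v' := funext hb₂
  exact ⟨hn, _, _, rfl, rfl, (eRel_embedding f₁ n hn a b).2 ((eRel_embedding f₂ n hn a b).1 h)⟩

/-- The class `K₀` has the amalgamation property. -/
theorem K0_amalgamation (A B₁ B₂ : CategoryTheory.Bundled.{0} L0.Structure)
    (hA : MemK0 A) (hB₁ : MemK0 B₁) (hB₂ : MemK0 B₂)
    (f₁ : A ↪[L0] B₁) (f₂ : A ↪[L0] B₂) :
    ∃ (C : CategoryTheory.Bundled.{0} L0.Structure) (g₁ : B₁ ↪[L0] C) (g₂ : B₂ ↪[L0] C),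
      MemK0 C ∧ g₁.comp f₁ = g₂.comp f₂ := by
  have := hB₁.1
  have := hB₂.1
  obtain ⟨C, g₁, g₂, hC, hg₁, hg₂, hcomm, hg⟩ :=
    exists_strong_amalgam f₁ f₂ f₁.injective f₂.injective
  have RS := fun n => PushRel.of_pushRel f₁ f₂ hg (n := n)
  have SR := fun n => PushRel.of_pushRel f₂ f₁
    (fun b₁ b₂ h => (hg b₂ b₁ h.symm).imp fun _ => And.symm) (n := n)
  let Am := fun n => AmalgRel (PermRel (C := C) (n := n)) (PushRel g₁ n) (PushRel g₂ n)
  let R : ∀ n, (Fin n → C) → (Fin n → C) → Prop := fun n x y =>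
    Function.Injective x ∧ Function.Injective y ∧ Am n x y
  let : L0.Structure C := structureOfRel R
  have hR : ∀ n hn (x y : Fin n → C), ERel n hn x y ↔ R n x y := eRel_structureOfRel R
  have amTrans : ∀ n (x y z : Fin n → C), Am n x y → Am n y z → Am n x z := fun n x y z =>
    AmalgRel.trans PermRel.symm (PushRel.symm hB₁) (PushRel.symm hB₂) PermRel.trans
      (PushRel.trans hB₁ hg₁) (PushRel.trans hB₂ hg₂) (PushRel.permRel_left hB₁)
      (PushRel.permRel_left hB₂) (RS n) (SR n)
  have e₁ : ∀ n hn (x y : Fin n → B₁), ERel n hn (g₁ ∘ x) (g₁ ∘ y) ↔ ERel n hn x y := by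
    intro n hn x y
    rw [hR]
    constructor
    · rintro ⟨hx, hy, h⟩
      have key := (hB₁.2 n hn).2.2.1
      exact (pushRel_comp hg₁ hn x y).1 <| AmalgRel.left (PushRel.symm hB₁)
        (PushRel.trans hB₁ hg₁) (PushRel.permRel_left hB₁) (RS n)
        ((pushRel_comp hg₁ hn x x).2 (key x hx.of_comp))
        ((pushRel_comp hg₁ hn y y).2 (key y hy.of_comp)) h
    · intro h
      obtain ⟨hx, hy⟩ := (hB₁.2 n hn).1 _ _ h
      exact ⟨hg₁.comp hx, hg₁.comp hy, Or.inr (Or.inl ((pushRel_comp hg₁ hn x y).2 h))⟩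
  have e₂ : ∀ n hn (x y : Fin n → B₂), ERel n hn (g₂ ∘ x) (g₂ ∘ y) ↔ ERel n hn x y := by
    intro n hn x y
    rw [hR]
    constructor
    · rintro ⟨hx, hy, h⟩
      have key := (hB₂.2 n hn).2.2.1
      exact (pushRel_comp hg₂ hn x y).1 <| AmalgRel.left (PushRel.symm hB₂)
        (PushRel.trans hB₂ hg₂) (PushRel.permRel_left hB₂) (SR n)
        ((pushRel_comp hg₂ hn x x).2 (key x hx.of_comp))
        ((pushRel_comp hg₂ hn y y).2 (key y hy.of_comp)) h.swap
    · intro h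
      obtain ⟨hx, hy⟩ := (hB₂.2 n hn).1 _ _ h
      exact ⟨hg₂.comp hx, hg₂.comp hy,
        Or.inr (Or.inr (Or.inl ((pushRel_comp hg₂ hn x y).2 h)))⟩
  refine ⟨⟨C, inferInstance⟩, embeddingOfERel g₁ hg₁ e₁, embeddingOfERel g₂ hg₂ e₂,
    ⟨hC, fun n hn => ?_⟩, Embedding.ext hcomm⟩
  change (∀ x y : Fin n → C, _) ∧ (∀ x y : Fin n → C, _) ∧ (∀ x : Fin n → C, _) ∧
    (∀ x y : Fin n → C, _) ∧ (∀ x y z : Fin n → C, _) ∧ (_ → ∀ x y : Fin n → C, _)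
  simp only [hR]
  refine ⟨fun x y h => ⟨h.1, h.2.1⟩, ?_, fun x hx => ⟨hx, hx, Or.inl ⟨1, rfl⟩⟩, ?_, ?_, ?_⟩
  · rintro x y σ τ ⟨hx, hy, h⟩
    exact ⟨hx.comp σ.injective, hy.comp τ.injective,
      amTrans n _ _ _ (Or.inl (PermRel.symm _ _ ⟨σ, rfl⟩))
        (amTrans n _ _ _ h (Or.inl ⟨τ, rfl⟩))⟩
  · rintro x y ⟨hx, hy, h⟩
    exact ⟨hy, hx, h.symm PermRel.symm (PushRel.symm hB₁) (PushRel.symm hB₂)⟩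
  · rintro x y z ⟨hx, -, h⟩ ⟨-, hz, h'⟩
    exact ⟨hx, hz, amTrans n _ _ _ h h'⟩
  · rintro hlt x - ⟨hx, -⟩
    have := Nat.card_le_card_of_injective x hx
    rw [Nat.card_fin] at this
    exact absurd hlt (not_lt.2 this)
end

section
/- There exists a Fraïssé limit of K₀, i.e. a countable ultrahomogeneous L₀-structure M whose age is, up to isomorphism, exactly K₀. -/
open FirstOrder FirstOrder.Language

instance L0.isRelational : L0.IsRelational := fun _ => inferInstanceAs (IsEmpty Empty)

namespace K0

/-! ### A generic colouring of the finite subsets of `ℕ` -/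

theorem exists_enumeration (α : Type*) [Countable α] [Nonempty α] :
    ∃ g : ℕ → α, ∀ (a : α) (N : ℕ), ∃ m, N < m ∧ g m = a := by
  obtain ⟨h, hh⟩ := exists_surjective_nat (α × ℕ)
  refine ⟨fun n => (h n).1, fun a N => ?_⟩
  have hinf : (h ⁻¹' {p | p.1 = a}).Infinite := by
    have hp : {p : α × ℕ | p.1 = a}.Infinite :=
      Set.infinite_of_injective_forall_mem (f := fun k : ℕ => (a, k))
        (fun _ _ hk => by simpa using hk) (fun _ => rfl)
    exact hp.preimage (by simp [hh.range_eq])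
  obtain ⟨m, hm, hN⟩ := hinf.exists_gt N
  exact ⟨m, hN, hm⟩

/-- Every colour pattern on the subsets of a finite set is realised by adjoining a new point. -/
theorem exists_generic_coloring :
    ∃ c : Finset ℕ → ℕ, ∀ (A : Finset ℕ) (F : Finset ℕ → ℕ),
      ∃ m, m ∉ A ∧ ∀ U ⊆ A, c (insert m U) = F U := by
  obtain ⟨g, hg⟩ := exists_enumeration (Finset ℕ →₀ ℕ)
  refine ⟨fun T => if h : T.Nonempty then g (T.max' h) (T.erase (T.max' h)) else 0,
    fun A F => ?_⟩
  obtain ⟨m, hm, hgm⟩ := hg (Finsupp.onFinset A.powerset (fun U => if U ⊆ A then F U else 0)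
    (fun U hU => by by_contra h; simp_all)) (A.sup id)
  have hlt : ∀ a ∈ A, a < m := fun a ha => (Finset.le_sup (f := id) ha).trans_lt hm
  refine ⟨m, fun h => (hlt m h).false, fun U hU => ?_⟩
  have hmax : (insert m U).max' (Finset.insert_nonempty m U) = m := by
    refine le_antisymm (Finset.max'_le _ _ _ fun a ha => ?_)
      (Finset.le_max' _ _ (Finset.mem_insert_self m U))
    rcases Finset.mem_insert.1 ha with rfl | ha
    · exact le_rfl
    · exact (hlt a (hU ha)).le
  have hmU : m ∉ U := fun h => (hlt m (hU h)).false
  simp [hmax, hgm, hU, Finset.erase_insert hmU]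

/-- The colouring used to define the Fraïssé limit. -/
noncomputable def color : Finset ℕ → ℕ := exists_generic_coloring.choose

theorem exists_color_insert (A : Finset ℕ) (F : Finset ℕ → ℕ) :
    ∃ m, m ∉ A ∧ ∀ U ⊆ A, color (insert m U) = F U :=
  exists_generic_coloring.choose_spec A F

/-- `e` is injective on `A` and matches the equality pattern of the colouring `q` on subsets of
`A` of equal cardinality at least `3` with that of `color`. -/
def PreservesColor {B : Type*} (q : Finset B → ℕ) (A : Finset B) (e : B → ℕ) : Prop :=
  Set.InjOn e A ∧ ∀ T ⊆ A, ∀ T' ⊆ A, 3 ≤ T.card → T.card = T'.card →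
    (q T = q T' ↔ color (T.image e) = color (T'.image e))

theorem PreservesColor.exists_color_eq {B : Type*} {q : Finset B → ℕ} {A : Finset B} {e : B → ℕ}
    (h : PreservesColor q A e) : ∃ Φ : ℕ → ℕ → ℕ,
      (∀ T ⊆ A, 3 ≤ T.card → Φ T.card (q T) = color (T.image e)) ∧
      ∀ k, 3 ≤ k → Function.Injective (Φ k) := by
  classical
  have hle : ∀ T ⊆ A, color (T.image e) ≤ A.powerset.sup fun T => color (T.image e) :=
    fun T hT => Finset.le_sup (f := fun T => color (T.image e)) (Finset.mem_powerset.2 hT)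
  set N := A.powerset.sup fun T => color (T.image e)
  let Φ : ℕ → ℕ → ℕ := fun k v => if h : ∃ T ⊆ A, T.card = k ∧ q T = v
    then color (h.choose.image e) else N + 1 + v
  have hΦ : ∀ T ⊆ A, 3 ≤ T.card → Φ T.card (q T) = color (T.image e) := by
    intro T hT h3
    have hex : ∃ T' ⊆ A, T'.card = T.card ∧ q T' = q T := ⟨T, hT, rfl, rfl⟩
    obtain ⟨h1, h2, h4⟩ := hex.choose_spec
    simp only [Φ, dif_pos hex]
    exact (h.2 _ h1 T hT (by omega) h2).1 h4
  refine ⟨Φ, hΦ, fun k hk v w hvw => ?_⟩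
  by_cases hv : ∃ T ⊆ A, T.card = k ∧ q T = v <;> by_cases hw : ∃ T ⊆ A, T.card = k ∧ q T = w
  · obtain ⟨T, hT, rfl, rfl⟩ := hv
    obtain ⟨T', hT', hc, rfl⟩ := hw
    rw [hΦ T hT hk, ← hc, hΦ T' hT' (by omega)] at hvw
    exact (h.2 T hT T' hT' hk hc.symm).2 hvw
  · obtain ⟨T, hT, rfl, rfl⟩ := hv
    rw [hΦ T hT hk] at hvw
    simp only [Φ, dif_neg hw] at hvw
    have := hle T hT
    omega
  · obtain ⟨T, hT, rfl, rfl⟩ := hw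
    rw [hΦ T hT hk] at hvw
    simp only [Φ, dif_neg hv] at hvw
    have := hle T hT
    omega
  · simp only [Φ, dif_neg hv, dif_neg hw] at hvw
    omega

theorem PreservesColor.exists_insert {B : Type*} [DecidableEq B] {q : Finset B → ℕ}
    {A : Finset B} {e : B → ℕ} (h : PreservesColor q A e) {b : B} (hb : b ∉ A) :
    ∃ m, PreservesColor q (insert b A) (Function.update e b m) := by
  obtain ⟨Φ, hΦ, hinj⟩ := h.exists_color_eq
  obtain ⟨m, hm, hmc⟩ := exists_color_insert (A.image e) fun U =>
    Φ (U.card + 1) (q (insert b (A.filter (e · ∈ U))))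
  have heq : ∀ a ∈ A, Function.update e b m a = e a := fun a ha =>
    Function.update_of_ne (by rintro rfl; exact hb ha) _ _
  have himage : ∀ T ⊆ A, T.image (Function.update e b m) = T.image e := fun T hT =>
    Finset.image_congr fun a ha => heq a (hT ha)
  have key : ∀ T ⊆ insert b A, 3 ≤ T.card →
      color (T.image (Function.update e b m)) = Φ T.card (q T) := by
    intro T hT h3
    by_cases hbT : b ∈ T
    · obtain ⟨S, hbS, rfl⟩ : ∃ S, b ∉ S ∧ insert b S = T :=
        ⟨T.erase b, Finset.notMem_erase b T, Finset.insert_erase hbT⟩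
      have hS : S ⊆ A := (Finset.insert_subset_insert_iff hbS).1 hT
      have hfilter : A.filter (e · ∈ S.image e) = S := by
        ext a
        simp only [Finset.mem_filter, Finset.mem_image]
        constructor
        · rintro ⟨ha, s, hs, hsa⟩
          rwa [← h.1 (hS hs) ha hsa]
        · exact fun ha => ⟨hS ha, a, ha, rfl⟩
      rw [Finset.image_insert, Function.update_self, himage S hS,
        hmc _ (Finset.image_subset_image hS), hfilter,
        Finset.card_image_of_injOn (h.1.mono (Finset.coe_subset.2 hS)),
        Finset.card_insert_of_notMem hbS]
    · have hTA : T ⊆ A := (Finset.subset_insert_iff_of_notMem hbT).1 hT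
      rw [himage T hTA, hΦ T hTA h3]
  refine ⟨m, ?_, fun T hT T' hT' h3 hcard => ?_⟩
  · rw [Finset.coe_insert, Set.injOn_insert (by simpa using hb)]
    refine ⟨h.1.congr fun a ha => (heq a ha).symm, ?_⟩
    rw [Function.update_self, ← Finset.coe_image, himage A subset_rfl]
    simpa using hm
  · rw [key T hT h3, key T' hT' (hcard ▸ h3), ← hcard, (hinj _ h3).eq_iff]

theorem PreservesColor.exists_univ {B : Type*} [Fintype B] {q : Finset B → ℕ}
    {A : Finset B} {e : B → ℕ} (h : PreservesColor q A e) :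
    ∃ e', PreservesColor q Finset.univ e' ∧ ∀ a ∈ A, e' a = e a := by
  classical
  suffices H : ∀ D : Finset B, ∃ e', PreservesColor q (D ∪ A) e' ∧ ∀ a ∈ A, e' a = e a by
    simpa only [Finset.union_eq_left.2 (Finset.subset_univ A)] using H Finset.univ
  intro D
  induction D using Finset.induction_on with
  | empty => exact ⟨e, by simpa using h, fun _ _ => rfl⟩
  | insert b D _ ih =>
    obtain ⟨e', he', hA⟩ := ih
    by_cases hb : b ∈ D ∪ A
    · exact ⟨e', by rwa [Finset.insert_union, Finset.insert_eq_of_mem hb], hA⟩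
    · obtain ⟨m, hm⟩ := he'.exists_insert hb
      refine ⟨Function.update e' b m, by rwa [Finset.insert_union], fun a ha => ?_⟩
      rw [Function.update_of_ne, hA a ha]
      rintro rfl
      exact hb (Finset.mem_union_right _ ha)

/-! ### Structures satisfying the axioms of `K₀` up to finiteness -/

/-- The axioms of `K₀` other than finiteness. -/
def EquivAxioms (B : Type*) [L0.Structure B] : Prop :=
  ∀ (n : ℕ) (hn : 3 ≤ n),
    (∀ x y : Fin n → B, ERel n hn x y → Function.Injective x ∧ Function.Injective y) ∧
    (∀ (x y : Fin n → B) (σ τ : Equiv.Perm (Fin n)),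
      ERel n hn x y → ERel n hn (x ∘ σ) (y ∘ τ)) ∧
    (∀ x : Fin n → B, Function.Injective x → ERel n hn x x) ∧
    (∀ x y : Fin n → B, ERel n hn x y → ERel n hn y x) ∧
    (∀ x y z : Fin n → B, ERel n hn x y → ERel n hn y z → ERel n hn x z)

theorem memK0_iff (B : Type*) [L0.Structure B] : MemK0 B ↔ Finite B ∧ EquivAxioms B := by
  refine and_congr_right fun _ => forall₂_congr fun n hn => ?_
  refine and_congr_right fun h => and_congr_right fun _ => and_congr_right fun _ =>
    and_congr_right fun _ => and_iff_left fun hcard x y hxy => ?_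
  have := Nat.card_le_card_of_injective x (h x y hxy).1
  rw [Nat.card_fin] at this
  omega

/-- `Eₙ` holds exactly when both halves are injective and their images have equal colours. -/
def IsColoring {B : Type*} [DecidableEq B] [L0.Structure B] (q : Finset B → ℕ) : Prop :=
  ∀ (n : ℕ) (hn : 3 ≤ n) (x y : Fin n → B), ERel n hn x y ↔
    Function.Injective x ∧ Function.Injective y ∧
      q (Finset.univ.image x) = q (Finset.univ.image y)

theorem IsColoring.equivAxioms {B : Type*} [DecidableEq B] [L0.Structure B] {q : Finset B → ℕ}
    (h : IsColoring q) : EquivAxioms B := by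
  intro n hn
  have himage : ∀ (x : Fin n → B) (σ : Equiv.Perm (Fin n)),
      Finset.univ.image (x ∘ σ) = Finset.univ.image x := by
    intro x σ
    rw [← Finset.image_image, Finset.image_univ_equiv]
  simp only [h n hn, himage]
  exact ⟨fun x y h => ⟨h.1, h.2.1⟩,
    fun x y σ τ h => ⟨h.1.comp σ.injective, h.2.1.comp τ.injective, h.2.2⟩,
    fun x hx => ⟨hx, hx, trivial⟩, fun x y h => ⟨h.2.1, h.1, h.2.2.symm⟩,
    fun x y z h h' => ⟨h.1, h'.2.1, h.2.2.trans h'.2.2⟩⟩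

theorem exists_perm_of_image_eq {B : Type*} [DecidableEq B] {n : ℕ} {x y : Fin n → B}
    (hx : Function.Injective x)
    (h : Finset.univ.image x = Finset.univ.image y) : ∃ σ : Equiv.Perm (Fin n), x = y ∘ σ := by
  have hex : ∀ i, ∃ j, y j = x i := fun i => by
    have : x i ∈ Finset.univ.image y := h ▸ Finset.mem_image_of_mem x (Finset.mem_univ i)
    simpa using this
  choose s hs using hex
  have hinj : Function.Injective s := fun i j hij => hx (by rw [← hs i, ← hs j, hij])
  exact ⟨Equiv.ofBijective s (Finite.injective_iff_bijective.1 hinj), funext fun i => (hs i).symm⟩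

theorem card_image_univ {B : Type*} [DecidableEq B] {n : ℕ} {x : Fin n → B}
    (hx : Function.Injective x) : (Finset.univ.image x).card = n := by
  rw [Finset.card_image_of_injective _ hx, Finset.card_fin]

theorem exists_injective_image_eq {B : Type*} [DecidableEq B] {n : ℕ} {T : Finset B}
    (hT : T.card = n) : ∃ x : Fin n → B, Function.Injective x ∧ Finset.univ.image x = T := by
  let f := (T.equivFinOfCardEq hT).symm
  refine ⟨fun i => f i, Subtype.val_injective.comp f.injective, ?_⟩
  ext b
  simp only [Finset.mem_image, Finset.mem_univ, true_and]
  exact ⟨by rintro ⟨i, rfl⟩; exact (f i).2, fun hb => ⟨f.symm ⟨b, hb⟩, by simp⟩⟩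

/-- The equivalence relation on finite subsets induced by the relations `Eₙ`. -/
def finsetSetoid {B : Type*} [DecidableEq B] [L0.Structure B] (h : EquivAxioms B) :
    Setoid (Finset B) where
  r T T' := T.card = T'.card ∧ ∀ (n : ℕ) (hn : 3 ≤ n) (x y : Fin n → B), Function.Injective x →
    Function.Injective y → Finset.univ.image x = T → Finset.univ.image y = T' → ERel n hn x y
  iseqv := by
    refine ⟨fun T => ⟨rfl, fun n hn x y hx hy hxT hyT => ?_⟩,
      fun hT => ⟨hT.1.symm, fun n hn x y hx hy hxT hyT =>
        (h n hn).2.2.2.1 _ _ (hT.2 n hn y x hy hx hyT hxT)⟩,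
      fun {T T' T''} hT hT' => ⟨hT.1.trans hT'.1, fun n hn x y hx hy hxT hyT => ?_⟩⟩
    · obtain ⟨σ, rfl⟩ := exists_perm_of_image_eq hx (hxT.trans hyT.symm)
      exact (h n hn).2.1 y y σ 1 ((h n hn).2.2.1 y hy)
    · obtain ⟨z, hz, hzT⟩ := exists_injective_image_eq (n := n) (T := T')
        (by rw [← hT.1, ← hxT, card_image_univ hx])
      exact (h n hn).2.2.2.2 x z y (hT.2 n hn x z hx hz hxT hzT) (hT'.2 n hn z y hz hy hzT hyT)

theorem EquivAxioms.exists_isColoring {B : Type*} [DecidableEq B] [L0.Structure B] [Countable B]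
    (h : EquivAxioms B) : ∃ q : Finset B → ℕ, IsColoring q := by
  obtain ⟨f, hf⟩ := Countable.exists_injective_nat (Quotient (finsetSetoid h))
  refine ⟨fun T => f (Quotient.mk _ T), fun n hn x y => ?_⟩
  rw [hf.eq_iff, Quotient.eq]
  constructor
  · intro hxy
    obtain ⟨hx, hy⟩ := (h n hn).1 x y hxy
    refine ⟨hx, hy, by rw [card_image_univ hx, card_image_univ hy], ?_⟩
    intro k hk x' y' hx' hy' hxx hyy
    obtain rfl : k = n := by rw [← card_image_univ hx', hxx, card_image_univ hx]
    obtain ⟨σ, rfl⟩ := exists_perm_of_image_eq hx' hxx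
    obtain ⟨τ, rfl⟩ := exists_perm_of_image_eq hy' hyy
    exact (h k hn).2.1 x y σ τ hxy
  · rintro ⟨hx, hy, hxy⟩
    exact hxy.2 n hn x y hx hy rfl rfl

/-! ### Embeddings of `L₀`-structures -/

theorem comp_append_cast {B C : Type*} (e : B → C) {n : ℕ} (x y : Fin n → B) :
    e ∘ (Fin.append x y ∘ Fin.cast (two_mul n)) =
      Fin.append (e ∘ x) (e ∘ y) ∘ Fin.cast (two_mul n) := by
  funext i
  simp only [Function.comp_apply]
  generalize Fin.cast (two_mul n) i = j
  refine Fin.addCases (fun j => ?_) (fun j => ?_) j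
  · rw [Fin.append_left, Fin.append_left, Function.comp_apply]
  · rw [Fin.append_right, Fin.append_right, Function.comp_apply]

theorem exists_eq_append {B : Type*} {n : ℕ} (v : Fin (2 * n) → B) :
    ∃ x y : Fin n → B, v = Fin.append x y ∘ Fin.cast (two_mul n) := by
  refine ⟨fun i => v (Fin.cast (two_mul n).symm (Fin.castAdd n i)),
    fun i => v (Fin.cast (two_mul n).symm (Fin.natAdd n i)), ?_⟩
  rw [Fin.append_castAdd_natAdd (f := fun i => v (Fin.cast (two_mul n).symm i))]
  rfl

theorem ERel_comp_embedding {B C : Type*} [L0.Structure B] [L0.Structure C] (e : B ↪[L0] C)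
    (n : ℕ) (hn : 3 ≤ n) (x y : Fin n → B) : ERel n hn (e ∘ x) (e ∘ y) ↔ ERel n hn x y := by
  unfold ERel
  rw [← comp_append_cast]
  exact e.map_rel _ _

/-- An injective map preserving and reflecting each `Eₙ` is an embedding. -/
def embeddingOfERel {B C : Type*} [L0.Structure B] [L0.Structure C] (e : B → C)
    (he : Function.Injective e)
    (hE : ∀ n hn (x y : Fin n → B), ERel n hn (e ∘ x) (e ∘ y) ↔ ERel n hn x y) : B ↪[L0] C where
  toFun := e
  inj' := he
  map_fun' f := f.elim
  map_rel' := by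
    rintro _ ⟨n, hn⟩ v
    obtain ⟨x, y, rfl⟩ := exists_eq_append v
    rw [comp_append_cast]
    exact hE n hn x y

theorem EquivAxioms.of_embedding {B C : Type*} [L0.Structure B] [L0.Structure C] (e : B ↪[L0] C)
    (h : EquivAxioms C) : EquivAxioms B := by
  intro n hn
  obtain ⟨h1, h2, h3, h4, h5⟩ := h n hn
  simp only [← ERel_comp_embedding e]
  exact ⟨fun x y hxy => ⟨(h1 _ _ hxy).1.of_comp, (h1 _ _ hxy).2.of_comp⟩,
    fun x y σ τ hxy => h2 _ _ σ τ hxy, fun x hx => h3 _ (e.injective.comp hx),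
    fun x y => h4 _ _, fun x y z => h5 _ _ _⟩

/-! ### The limit structure -/

/-- The structure on `ℕ` whose relations `Eₙ` are equality of colours. -/
noncomputable instance limitStructure : L0.Structure ℕ where
  funMap f := f.elim
  RelMap {k} r := match k, r with
    | _, L0Rel.E n _ => fun v =>
      ∃ x y : Fin n → ℕ, v = Fin.append x y ∘ Fin.cast (two_mul n) ∧ Function.Injective x ∧
        Function.Injective y ∧ color (Finset.univ.image x) = color (Finset.univ.image y)

theorem isColoring_color : IsColoring color := by
  intro n hn x y
  constructor
  · rintro ⟨x', y', hv, h⟩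
    have hv' : Fin.append x y = Fin.append x' y' := by
      funext i
      exact congrFun hv (Fin.cast (two_mul n).symm i)
    have hx : x = x' := funext fun i => by simpa using congrFun hv' (Fin.castAdd n i)
    have hy : y = y' := funext fun i => by
      simpa only [Fin.append_right] using congrFun hv' (Fin.natAdd n i)
    rwa [hx, hy]
  · exact fun h => ⟨x, y, rfl, h⟩

/-- A colour-preserving map defined everywhere is an embedding into the limit. -/
theorem PreservesColor.exists_embedding {B : Type*} [DecidableEq B] [Fintype B] [L0.Structure B]
    {q : Finset B → ℕ} (hq : IsColoring q) {e : B → ℕ}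
    (h : PreservesColor q Finset.univ e) : ∃ f : B ↪[L0] ℕ, ∀ b, f b = e b := by
  have he : Function.Injective e := by simpa [Set.injOn_univ] using h.1
  refine ⟨embeddingOfERel e he fun n hn x y => ?_, fun _ => rfl⟩
  rw [isColoring_color n hn, hq n hn, he.of_comp_iff, he.of_comp_iff]
  refine and_congr_right fun hx => and_congr_right fun hy => ?_
  rw [h.2 _ (Finset.subset_univ _) _ (Finset.subset_univ _) (by rwa [card_image_univ hx])
    (by rw [card_image_univ hx, card_image_univ hy]), Finset.image_image, Finset.image_image]

theorem exists_embedding_extending {S B : Type*} [L0.Structure S] [L0.Structure B] [Finite B]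
    (hB : EquivAxioms B) (g : S ↪[L0] B) (f : S ↪[L0] ℕ) :
    ∃ f' : B ↪[L0] ℕ, f = f'.comp g := by
  classical
  have := Fintype.ofFinite B
  have : Finite S := Finite.of_injective g g.injective
  have := Fintype.ofFinite S
  obtain ⟨q, hq⟩ := hB.exists_isColoring
  let e : B → ℕ := Function.extend g f 0
  have heg : ∀ s, e (g s) = f s := fun s => g.injective.extend_apply f 0 s
  have hpres : PreservesColor q (Finset.univ.image g) e := by
    constructor
    · simp only [Finset.coe_image, Finset.coe_univ, Set.image_univ]
      rintro _ ⟨s, rfl⟩ _ ⟨t, rfl⟩ hst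
      rw [heg, heg] at hst
      rw [f.injective hst]
    · intro T hT T' hT' h3 hcard
      obtain ⟨U, -, rfl⟩ := Finset.subset_image_iff.1 hT
      obtain ⟨U', -, rfl⟩ := Finset.subset_image_iff.1 hT'
      rw [Finset.card_image_of_injective _ g.injective] at h3 hcard
      rw [Finset.card_image_of_injective _ g.injective] at hcard
      obtain ⟨n, hn⟩ : ∃ n, U.card = n := ⟨_, rfl⟩
      rw [hn] at h3 hcard
      obtain ⟨x, hx, rfl⟩ := exists_injective_image_eq hn
      obtain ⟨y, hy, rfl⟩ := exists_injective_image_eq hcard.symm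
      have hfg : e ∘ g = f := funext heg
      have h1 := hq _ h3 (g ∘ x) (g ∘ y)
      have h2 := isColoring_color _ h3 (f ∘ x) (f ∘ y)
      rw [ERel_comp_embedding] at h1 h2
      simp only [g.injective.comp hx, g.injective.comp hy, f.injective.comp hx,
        f.injective.comp hy, true_and] at h1 h2
      simp only [Finset.image_image, ← Function.comp_assoc, hfg]
      rw [← h1, ← h2]
  obtain ⟨e', he', hA⟩ := hpres.exists_univ
  obtain ⟨f', hf'⟩ := he'.exists_embedding hq
  refine ⟨f', ?_⟩
  ext s
  rw [Embedding.comp_apply, hf', hA _ (Finset.mem_image_of_mem _ (Finset.mem_univ s)), heg]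

theorem exists_embedding {B : Type*} [L0.Structure B] [Finite B] (hB : EquivAxioms B) :
    Nonempty (B ↪[L0] ℕ) := by
  classical
  have := Fintype.ofFinite B
  obtain ⟨q, hq⟩ := hB.exists_isColoring
  have h0 : PreservesColor q ∅ fun _ => 0 :=
    ⟨by simp, fun T hT _ _ h3 => by simp [Finset.subset_empty.1 hT] at h3⟩
  obtain ⟨e, he, -⟩ := h0.exists_univ
  obtain ⟨f, -⟩ := he.exists_embedding hq
  exact ⟨f⟩

theorem isUltrahomogeneous_limit : L0.IsUltrahomogeneous ℕ := by
  rw [isUltrahomogeneous_iff_IsExtensionPair Structure.cg_of_countable,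
    isExtensionPair_iff_exists_embedding_closure_singleton_sup]
  intro S hS f m
  have : Finite ↥(Substructure.closure L0 {m} ⊔ S) :=
    ((Substructure.fg_closure_singleton m).sup hS).finite
  exact exists_embedding_extending
    (isColoring_color.equivAxioms.of_embedding (Substructure.subtype _)) _ f

end K0

/-- There exists a Fraïssé limit of `K₀`: a countable ultrahomogeneous
`L₀`-structure `M` whose age is, up to isomorphism, exactly `K₀`. -/
theorem K0_exists_fraisse_limit :
    ∃ M : CategoryTheory.Bundled.{0} L0.Structure, Countable M ∧
      L0.IsUltrahomogeneous M ∧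
      ∀ N : CategoryTheory.Bundled.{0} L0.Structure, N ∈ L0.age M ↔ MemK0 N := by
  refine ⟨⟨ℕ, K0.limitStructure⟩, inferInstanceAs (Countable ℕ), K0.isUltrahomogeneous_limit,
    fun N => ?_⟩
  rw [K0.memK0_iff]
  constructor
  · rintro ⟨hfg, ⟨e⟩⟩
    exact ⟨hfg.finite, K0.isColoring_color.equivAxioms.of_embedding e⟩
  · rintro ⟨hfin, hN⟩
    exact ⟨Structure.FG.of_finite, K0.exists_embedding hN⟩
end

section
/- Let M be a Fraïssé limit of K₀. Then the complete first-order theory of M is ℵ₀-categorical: any two countable models of Th(M) are isomorphic. -/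
open FirstOrder FirstOrder.Language

/-- `M` is a Fraïssé limit of `K₀`: a countable ultrahomogeneous `L₀`-structure whose
age (the class of structures isomorphic to finite substructures of `M`) is exactly `K₀`
up to isomorphism. -/
def IsFraisseLimitK0 (M : Type) [L0.Structure M] : Prop :=
  Countable M ∧ L0.IsUltrahomogeneous M ∧
    ∀ N : CategoryTheory.Bundled.{0} L0.Structure, N ∈ L0.age M ↔ MemK0 N

namespace FirstOrder.Language

open Structure Substructure

universe u v w

variable {L : Language.{u, v}}

/-- The relation symbols that hold, in `M`, of some tuple with at most `k` distinct entries. -/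
def relationsOfSize (L : Language.{u, v}) (M : Type w) [L.Structure M] (k : ℕ) :
    Set (Σ n, L.Relations n) :=
  {R | ∃ x : Fin R.1 → M, RelMap R.2 x ∧ (Set.range x).ncard ≤ k}

/-- A structure satisfying the complete theory of `M` has no more relations on small tuples
than `M` does. -/
theorem relationsOfSize_subset_of_models_completeTheory {M N : Type w} [L.Structure M]
    [L.Structure N] [N ⊨ L.completeTheory M] (k : ℕ) :
    L.relationsOfSize N k ⊆ L.relationsOfSize M k := by
  rintro ⟨n, R⟩ ⟨x, hx, hk⟩
  let φ : L.Formula (Empty ⊕ Set.range x) :=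
    R.formula fun i => Term.var (Sum.inr (Set.rangeFactorization x i))
  have hN : N ⊨ φ.iExs (Set.range x) :=
    Formula.realize_iExs.2 ⟨Subtype.val, Formula.realize_rel.2 hx⟩
  obtain ⟨y, hy⟩ :=
    Formula.realize_iExs.1 ((realize_iff_of_model_completeTheory M N _).1 hN)
  refine ⟨y ∘ Set.rangeFactorization x, Formula.realize_rel.1 hy, le_trans ?_ hk⟩
  calc (Set.range (y ∘ Set.rangeFactorization x)).ncard
      ≤ (Set.range y).ncard :=
        Set.ncard_le_ncard (Set.range_comp_subset_range _ _) (Set.finite_range y)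
    _ = (y '' Set.univ).ncard := by rw [Set.image_univ]
    _ ≤ (Set.univ : Set (Set.range x)).ncard := Set.ncard_image_le
    _ = (Set.range x).ncard := by rw [Set.ncard_univ, Nat.card_coe_set_eq]

/-- If only finitely many relation symbols hold in `M` of tuples of any bounded size, then every
finite structure embeddable in a model of the complete theory of `M` is described by a formula
whose realizations, in all models of that theory, are the embeddings of the structure. -/
theorem exists_formula_realize_iff_embedding [L.IsRelational] {M : Type w} [L.Structure M]
    (hfin : ∀ k, (L.relationsOfSize M k).Finite) {N₀ : Type w} [L.Structure N₀]
    [N₀ ⊨ L.completeTheory M] {T : Type w} [L.Structure T] [Finite T] (e₀ : T ↪[L] N₀) :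
    ∃ θ : L.Formula T, ∀ (N : Type w) [L.Structure N] [N ⊨ L.completeTheory M] (d : T → N),
      θ.Realize d ↔ ∃ e : T ↪[L] N, ⇑e = d := by
  classical
  have := (hfin (Nat.card T)).to_subtype
  have hsize : ∀ (N : Type w) [L.Structure N] [N ⊨ L.completeTheory M] (d : T → N) {n : ℕ}
      (R : L.Relations n) (t : Fin n → T), RelMap R (d ∘ t) →
      (⟨n, R⟩ : Σ n, L.Relations n) ∈ L.relationsOfSize M (Nat.card T) := by
    intro N _ _ d n R t h
    refine relationsOfSize_subset_of_models_completeTheory (N := N) _ ⟨d ∘ t, h, ?_⟩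
    calc (Set.range (d ∘ t)).ncard = (d '' Set.range t).ncard := by rw [Set.range_comp]
      _ ≤ (Set.range t).ncard := Set.ncard_image_le
      _ ≤ Nat.card T := by
        rw [← Set.ncard_univ]; exact Set.ncard_le_ncard (Set.subset_univ _)
  let eqs : L.Formula T := Formula.iInf fun p : {p : T × T // p.1 ≠ p.2} =>
    ∼((Term.var p.1.1).equal (Term.var p.1.2))
  let rels : L.Formula T := Formula.iInf
    fun p : Σ R : L.relationsOfSize M (Nat.card T), Fin R.1.1 → T =>
      if RelMap p.1.1.2 p.2 then p.1.1.2.formula (fun i => Term.var (p.2 i))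
      else ∼(p.1.1.2.formula fun i => Term.var (p.2 i))
  refine ⟨eqs ⊓ rels, fun N _ _ d => ?_⟩
  have heqs : eqs.Realize d ↔ Function.Injective d := by
    simp only [eqs, Formula.realize_iInf, Formula.realize_not, Formula.realize_equal,
      Term.realize_var, Subtype.forall, Prod.forall, Function.Injective]
    exact forall₂_congr fun a b => not_imp_not
  have hrels : rels.Realize d ↔ ∀ p : Σ R : L.relationsOfSize M (Nat.card T), Fin R.1.1 → T,
      (RelMap p.1.1.2 (d ∘ p.2) ↔ RelMap p.1.1.2 p.2) := by
    simp only [rels, Formula.realize_iInf]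
    refine forall_congr' fun p => ?_
    split_ifs with h
    · simp only [h, iff_true]
      exact Formula.realize_rel
    · simp only [h, iff_false, Formula.realize_not]
      exact not_congr Formula.realize_rel
  rw [Formula.realize_inf, heqs, hrels]
  constructor
  · rintro ⟨hinj, hrel⟩
    refine ⟨⟨⟨d, hinj⟩, fun f => isEmptyElim f, fun {n} R t => ?_⟩, rfl⟩
    by_cases hR : (⟨n, R⟩ : Σ n, L.Relations n) ∈ L.relationsOfSize M (Nat.card T)
    · exact hrel ⟨⟨⟨n, R⟩, hR⟩, t⟩
    · exact iff_of_false (fun h => hR (hsize N d R t h))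
        fun h => hR (hsize N₀ e₀ R t ((e₀.map_rel R t).2 h))
  · rintro ⟨e, rfl⟩
    exact ⟨e.injective, fun p => e.map_rel _ _⟩

section

variable [L.IsRelational] {M : Type w} [L.Structure M]
  {N₁ N₂ : Type w} [L.Structure N₁] [L.Structure N₂]

/-- Models of the complete theory of `M` have the same finite substructures. -/
theorem nonempty_embedding_of_models_completeTheory
    (hfin : ∀ k, (L.relationsOfSize M k).Finite) [N₁ ⊨ L.completeTheory M]
    [N₂ ⊨ L.completeTheory M] {T : Type w} [L.Structure T] [Finite T] (e : T ↪[L] N₁) :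
    Nonempty (T ↪[L] N₂) := by
  obtain ⟨θ, hθ⟩ := exists_formula_realize_iff_embedding hfin e
  have h₁ : N₁ ⊨ Formula.iExs (α := Empty) T (θ.relabel Sum.inr) :=
    Formula.realize_iExs.2 ⟨e, Formula.realize_relabel.2 ((hθ N₁ _).2 ⟨e, rfl⟩)⟩
  have h₂ := (realize_iff_of_model_completeTheory M N₂ _).2
    ((realize_iff_of_model_completeTheory M N₁ _).1 h₁)
  obtain ⟨d, hd⟩ := Formula.realize_iExs.1 h₂
  obtain ⟨g, -⟩ := (hθ N₂ _).1 (Formula.realize_relabel.1 hd)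
  exact ⟨g⟩

/-- Any two models of the complete theory of an ultrahomogeneous structure `M` form an extension
pair, provided only finitely many relation symbols hold in `M` of tuples of any bounded size. -/
theorem IsUltrahomogeneous.isExtensionPair_of_models_completeTheory
    (hM : L.IsUltrahomogeneous M) (hfin : ∀ k, (L.relationsOfSize M k).Finite)
    [N₁ ⊨ L.completeTheory M] [N₂ ⊨ L.completeTheory M] : L.IsExtensionPair N₁ N₂ := by
  rw [isExtensionPair_iff_exists_embedding_closure_singleton_sup]
  intro S hS f m
  have : Finite S := hS.finite
  have hT : (closure L {m} ⊔ S : L.Substructure N₁).FG := (fg_closure_singleton m).sup hS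
  generalize hι : (inclusion le_sup_right : S ↪[L] (closure L {m} ⊔ S : L.Substructure N₁)) = ι
  clear hι
  generalize closure L {m} ⊔ S = T at *
  have : Finite T := hT.finite
  obtain ⟨θS, hθS⟩ := exists_formula_realize_iff_embedding hfin S.subtype
  obtain ⟨θT, hθT⟩ := exists_formula_realize_iff_embedding hfin T.subtype
  let ext : L.Formula (S ⊕ T) := θT.relabel Sum.inr ⊓
    Formula.iInf fun s : S => (Term.var (Sum.inr (ι s))).equal (Term.var (Sum.inl s))
  have hext : ∀ (N : Type w) [L.Structure N] [N ⊨ L.completeTheory M] (c : S → N),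
      (ext.iExs T).Realize c ↔ ∃ g : T ↪[L] N, ⇑g ∘ ι = c := by
    intro N _ _ c
    simp only [ext, Formula.realize_iExs, Formula.realize_inf, Formula.realize_relabel,
      Formula.realize_iInf, Formula.realize_equal, Term.realize_var, Sum.elim_inl, Sum.elim_inr,
      Sum.elim_comp_inr, hθT, funext_iff, Function.comp_apply]
    constructor
    · rintro ⟨d, ⟨g, hg⟩, hd⟩
      exact ⟨g, fun s => (hg _).trans (hd s)⟩
    · rintro ⟨g, hg⟩
      exact ⟨g, ⟨g, fun _ => rfl⟩, hg⟩
  let σ : L.Sentence := Formula.iAlls (α := Empty) S ((θS.imp (ext.iExs T)).relabel Sum.inr)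
  have hσ : ∀ (N : Type w) [L.Structure N] [N ⊨ L.completeTheory M],
      N ⊨ σ ↔ ∀ f : S ↪[L] N, ∃ g : T ↪[L] N, f = g.comp ι := by
    intro N _ _
    have hrelabel (c : S → N) : ((θS.imp (ext.iExs T)).relabel Sum.inr).Realize
        (Sum.elim (default : Empty → N) c) ↔ (θS.Realize c → (ext.iExs T).Realize c) :=
      Formula.realize_relabel.trans Formula.realize_imp
    refine (Formula.realize_iAlls.trans (forall_congr' hrelabel)).trans ?_
    constructor
    · intro h f
      obtain ⟨g, hg⟩ := (hext N _).1 (h f ((hθS N _).2 ⟨f, rfl⟩))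
      exact ⟨g, DFunLike.coe_injective hg.symm⟩
    · intro h c hc
      obtain ⟨f, rfl⟩ := (hθS N _).1 hc
      obtain ⟨g, rfl⟩ := h f
      exact (hext N _).2 ⟨g, rfl⟩
  have : Nonempty (T ↪[L] M) := nonempty_embedding_of_models_completeTheory hfin T.subtype
  exact (hσ N₂).1 ((realize_iff_of_model_completeTheory M N₂ σ).2
    ((hσ M).2 fun f => hM.extend_embedding FG.of_finite f ι)) f

/-- The complete theory of an ultrahomogeneous structure `M` in a relational language is
ℵ₀-categorical, provided only finitely many relation symbols hold in `M` of tuples of any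
bounded size. -/
theorem IsUltrahomogeneous.nonempty_equiv_of_models_completeTheory
    (hM : L.IsUltrahomogeneous M) (hfin : ∀ k, (L.relationsOfSize M k).Finite)
    [N₁ ⊨ L.completeTheory M] [N₂ ⊨ L.completeTheory M] [Countable N₁] [Countable N₂] :
    Nonempty (N₁ ≃[L] N₂) := by
  have hbot : (⊥ : L.Substructure N₁).FG := fg_bot
  have : Finite (⊥ : L.Substructure N₁) := hbot.finite
  obtain ⟨e⟩ := nonempty_embedding_of_models_completeTheory (N₂ := N₂) hfin
    (⊥ : L.Substructure N₁).subtype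
  obtain ⟨g, -⟩ := equiv_between_cg cg_of_countable cg_of_countable
    ⟨⟨⊥, e.toHom.range, e.equivRange⟩, hbot⟩
    (hM.isExtensionPair_of_models_completeTheory hfin)
    (hM.isExtensionPair_of_models_completeTheory hfin)
  exact ⟨g⟩

end

end FirstOrder.Language

instance : L0.IsRelational := fun _ => inferInstanceAs (IsEmpty Empty)

theorem IsFraisseLimitK0.injective_of_eRel {M : Type} [L0.Structure M] (hM : IsFraisseLimitK0 M)
    {n : ℕ} (hn : 3 ≤ n) {x y : Fin n → M} (h : ERel n hn x y) : Function.Injective x := by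
  let S : L0.Substructure M := Substructure.closure L0 (Set.range x ∪ Set.range y)
  have hS : S.FG := Substructure.fg_closure ((Set.finite_range x).union (Set.finite_range y))
  have hK : MemK0 S := (hM.2.2 ⟨S, inferInstance⟩).1 (age.fg_substructure hS)
  let x' : Fin n → S := fun i => ⟨x i, Substructure.subset_closure (.inl ⟨i, rfl⟩)⟩
  let y' : Fin n → S := fun i => ⟨y i, Substructure.subset_closure (.inr ⟨i, rfl⟩)⟩
  have h' : ERel n hn x' y' := by
    refine (S.subtype.map_rel _ _).1 ?_
    unfold ERel at h
    convert h using 1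
    funext i
    rw [Function.comp_apply, Function.comp_apply, Function.comp_apply]
    refine Fin.addCases (fun j => ?_) (fun j => ?_) (Fin.cast (two_mul n) i)
    · rw [Fin.append_left, Fin.append_left]; rfl
    · rw [Fin.append_right, Fin.append_right]; rfl
  exact fun i j hij => ((hK.2 n hn).1 x' y' h').1 (Subtype.ext hij)

theorem IsFraisseLimitK0.finite_relationsOfSize {M : Type} [L0.Structure M]
    (hM : IsFraisseLimitK0 M) (k : ℕ) : (L0.relationsOfSize M k).Finite := by
  refine (Set.finite_range fun n : {n : Fin (k + 1) // 3 ≤ n.1} =>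
    (⟨2 * n.1.1, L0Rel.E n.1 n.2⟩ : Σ n, L0.Relations n)).subset ?_
  rintro ⟨_, ⟨n, hn⟩⟩ ⟨z, hz, hk⟩
  let z' : Fin (n + n) → M := z ∘ Fin.cast (two_mul n).symm
  have hE : ERel n hn (z' ∘ Fin.castAdd n) (z' ∘ Fin.natAdd n) := by
    unfold ERel
    convert hz using 1
    exact congrArg (· ∘ Fin.cast (two_mul n)) (Fin.append_castAdd_natAdd (f := z'))
  have hcard : n ≤ k := by
    refine le_trans ?_ hk
    calc n = (Set.range (z' ∘ Fin.castAdd n)).ncard := by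
          rw [← Set.image_univ, Set.ncard_image_of_injective _ (hM.injective_of_eRel hn hE),
            Set.ncard_univ, Nat.card_fin]
      _ ≤ (Set.range z).ncard :=
          Set.ncard_le_ncard (Set.range_comp_subset_range (Fin.cast _ ∘ Fin.castAdd n) z)
            (Set.finite_range z)
  exact ⟨⟨⟨n, Nat.lt_succ_of_le hcard⟩, hn⟩, rfl⟩

/-- The complete theory of a Fraïssé limit of `K₀` is ℵ₀-categorical:
any two countable models of `Th(M)` are isomorphic. -/
theorem fraisse_limit_aleph0_categorical (M : Type) [L0.Structure M]
    (hM : IsFraisseLimitK0 M) :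
    ∀ N₁ N₂ : Theory.ModelType.{0, 0, 0} (L0.completeTheory M),
      Countable N₁ → Countable N₂ → Nonempty (N₁ ≃[L0] N₂) := by
  intro N₁ N₂ _ _
  exact hM.2.1.nonempty_equiv_of_models_completeTheory hM.finite_relationsOfSize
end

section
/- Let M be a Fraïssé limit of K₀. Then M does not have an AZ-enumeration: there is no linear order ≺ on M of order type ω such that for every n ≥ 1 and every sequence (b̄ᵢ)_{i∈ℕ} of n-tuples from M there exist i < j and an elementary embedding f : M → M which is strictly ≺-increasing and satisfies f(b̄ᵢ) = b̄ⱼ. -/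
open FirstOrder FirstOrder.Language

namespace L0

instance (n : ℕ) : IsEmpty (L0.Functions n) := inferInstanceAs (IsEmpty Empty)

instance : L0.IsRelational := fun _ => inferInstanceAs (IsEmpty Empty)

/-- The `L₀`-structure in which `Eₙ` is interpreted by the relation `R n` between `n`-tuples. -/
abbrev structureOfRel {α : Type*} (R : ∀ n : ℕ, (Fin n → α) → (Fin n → α) → Prop) :
    L0.Structure α where
  funMap f := isEmptyElim f
  RelMap {_} r := match r with
    | L0Rel.E n _ => fun v => R n (fun i => v (Fin.cast (two_mul n).symm (Fin.castAdd n i)))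
        (fun i => v (Fin.cast (two_mul n).symm (Fin.natAdd n i)))

lemma eRel_structureOfRel {α : Type*} (R : ∀ n : ℕ, (Fin n → α) → (Fin n → α) → Prop)
    (n : ℕ) (hn : 3 ≤ n) (x y : Fin n → α) :
    @ERel α (structureOfRel R) n hn x y ↔ R n x y := by
  have hx : x = fun i => (Fin.append x y ∘ Fin.cast (two_mul n))
      (Fin.cast (two_mul n).symm (Fin.castAdd n i)) := by funext i; simp
  have hy : y = fun i => (Fin.append x y ∘ Fin.cast (two_mul n))
      (Fin.cast (two_mul n).symm (Fin.natAdd n i)) := by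
    funext i; simp [-Fin.natAdd_eq_addNat]
  exact Iff.trans Iff.rfl (iff_of_eq (congrArg₂ (R n) hx.symm hy.symm))

lemma exists_append_cast {α : Type*} {n : ℕ} (v : Fin (2 * n) → α) :
    ∃ x y : Fin n → α, v = Fin.append x y ∘ Fin.cast (two_mul n) := by
  refine ⟨fun i => v (Fin.cast (two_mul n).symm (Fin.castAdd n i)),
    fun i => v (Fin.cast (two_mul n).symm (Fin.natAdd n i)), ?_⟩
  funext i
  obtain ⟨i, rfl⟩ := (finCongr (two_mul n).symm).surjective i
  induction i using Fin.addCases <;> simp [-Fin.natAdd_eq_addNat]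

lemma comp_append_cast {α β : Type*} {n : ℕ} (f : α → β) (x y : Fin n → α) :
    f ∘ (Fin.append x y ∘ Fin.cast (two_mul n)) =
      Fin.append (f ∘ x) (f ∘ y) ∘ Fin.cast (two_mul n) := by
  funext i
  obtain ⟨i, rfl⟩ := (finCongr (two_mul n).symm).surjective i
  induction i using Fin.addCases <;> simp [-Fin.natAdd_eq_addNat]

lemma eRel_map {A B : Type*} [L0.Structure A] [L0.Structure B] (f : A ↪[L0] B) {n : ℕ}
    (hn : 3 ≤ n) (x y : Fin n → A) : ERel n hn (f ∘ x) (f ∘ y) ↔ ERel n hn x y := by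
  rw [ERel, ← comp_append_cast]
  exact f.map_rel (L0Rel.E n hn : L0.Relations (2 * n)) _

/-- An injective map that preserves and reflects every `Eₙ` is an embedding. -/
def embeddingOfERel {A B : Type*} [L0.Structure A] [L0.Structure B] (f : A ↪ B)
    (h : ∀ (n : ℕ) (hn : 3 ≤ n) (x y : Fin n → A),
      ERel n hn (f ∘ x) (f ∘ y) ↔ ERel n hn x y) : A ↪[L0] B where
  toEmbedding := f
  map_fun' g := isEmptyElim g
  map_rel' r v := by
    obtain ⟨n, hn⟩ := r
    obtain ⟨x, y, rfl⟩ := exists_append_cast v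
    have := h n hn x y
    rwa [ERel, ← comp_append_cast] at this

end L0

namespace IsFraisseLimitK0

variable {M : Type} [L0.Structure M]

lemma memK0_substructure (hM : IsFraisseLimitK0 M) (S : L0.Substructure M)
    (hS : (S : Set M).Finite) : MemK0 S := by
  have : Finite S := hS
  exact (hM.2.2 (CategoryTheory.Bundled.of S)).1
    ⟨Structure.FG.of_finite (L := L0) (M := S), ⟨S.subtype⟩⟩

lemma exists_memK0_substructure (hM : IsFraisseLimitK0 M) {s : Set M} (hs : s.Finite) :
    ∃ S : L0.Substructure M, (S : Set M) = s ∧ MemK0 S := by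
  have h : (Substructure.closure L0 s : Set M) = s := Substructure.closure_eq_of_isRelational L0 s
  exact ⟨_, h, hM.memK0_substructure _ (h.symm ▸ hs)⟩

/-- The relations of a one-point extension of `S` in which, for `n < |S|`, the `n`-sets
containing the new point form a new class, and for `n ≥ |S|` all `n`-sets are equivalent. -/
def extRel (S : L0.Substructure M) (n : ℕ) (x y : Fin n → Option S) : Prop :=
  Function.Injective x ∧ Function.Injective y ∧ (Nat.card S ≤ n ∨
    ((∃ i, x i = none) ∧ ∃ i, y i = none) ∨
    ∃ (hn : 3 ≤ n) (x' y' : Fin n → S), x = some ∘ x' ∧ y = some ∘ y' ∧ ERel n hn x' y')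

lemma some_comp_inj {α : Type*} {n : ℕ} {x y : Fin n → α}
    (h : (some ∘ x : Fin n → Option α) = some ∘ y) : x = y :=
  (Option.some_injective α).comp_left h

lemma eq_some_comp_or {α : Type*} {n : ℕ} (x : Fin n → Option α) :
    (∃ i, x i = none) ∨ ∃ x' : Fin n → α, x = some ∘ x' := by
  by_cases h : ∃ i, x i = none
  · exact .inl h
  · push Not at h
    choose x' hx' using fun i => Option.ne_none_iff_exists'.1 (h i)
    exact .inr ⟨x', funext hx'⟩

lemma memK0_ext {S : L0.Substructure M} (hS : MemK0 S) :
    @MemK0 (Option S) (L0.structureOfRel (extRel S)) := by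
  let _ := L0.structureOfRel (extRel S)
  have := hS.1
  refine ⟨inferInstance, fun n hn => ?_⟩
  obtain ⟨-, hperm, hrefl, hsymm, htrans, -⟩ := hS.2 n hn
  simp only [L0.eRel_structureOfRel]
  refine ⟨fun x y h => ⟨h.1, h.2.1⟩, ?_, ?_, ?_, ?_, ?_⟩
  · rintro x y σ τ ⟨hx, hy, h⟩
    refine ⟨hx.comp σ.injective, hy.comp τ.injective, ?_⟩
    obtain h | ⟨⟨i, hi⟩, j, hj⟩ | ⟨_, x', y', rfl, rfl, h⟩ := h
    · exact .inl h
    · exact .inr (.inl ⟨⟨σ.symm i, by simpa⟩, τ.symm j, by simpa⟩)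
    · exact .inr (.inr ⟨hn, x' ∘ σ, y' ∘ τ, rfl, rfl, hperm _ _ σ τ h⟩)
  · intro x hx
    refine ⟨hx, hx, .inr ?_⟩
    obtain h | ⟨x', rfl⟩ := eq_some_comp_or x
    · exact .inl ⟨h, h⟩
    · exact .inr ⟨hn, x', x', rfl, rfl, hrefl _ hx.of_comp⟩
  · rintro x y ⟨hx, hy, h⟩
    refine ⟨hy, hx, h.imp_right (Or.imp And.symm ?_)⟩
    clear h
    rintro ⟨_, x', y', rfl, rfl, h⟩
    exact ⟨hn, y', x', rfl, rfl, hsymm _ _ h⟩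
  · rintro x y z ⟨hx, hy, h⟩ ⟨-, hz, h'⟩
    refine ⟨hx, hz, ?_⟩
    obtain h | h | ⟨_, x', y', rfl, rfl, h⟩ := h
    · exact .inl h
    · obtain h' | h' | ⟨_, y', z', rfl, rfl, -⟩ := h'
      · exact .inl h'
      · exact .inr (.inl ⟨h.1, h'.2⟩)
      · simp at h
    · obtain h' | h' | ⟨_, y'', z', hy', rfl, h'⟩ := h'
      · exact .inl h'
      · simp at h'
      · obtain rfl := some_comp_inj hy'
        exact .inr (.inr ⟨hn, x', z', rfl, rfl, htrans _ _ _ h h'⟩)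
  · intro hlt x y h
    have := Nat.card_le_card_of_injective x h.1
    simp only [Nat.card_fin] at this
    omega

lemma extRel_some_iff {S : L0.Substructure M} (hS : MemK0 S) {n : ℕ}
    (hn : 3 ≤ n) (x y : Fin n → S) :
    extRel S n (some ∘ x) (some ∘ y) ↔ ERel n hn x y := by
  have := hS.1
  constructor
  · rintro ⟨hx, hy, h | h | ⟨_, x', y', hx', hy', h⟩⟩
    · have hx := hx.of_comp
      have hy := hy.of_comp
      have hcard : Nat.card (Fin n) = Nat.card S :=
        le_antisymm (Nat.card_le_card_of_injective x hx) (by simpa using h)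
      have hbx := (Nat.bijective_iff_injective_and_card x).2 ⟨hx, hcard⟩
      have hby := (Nat.bijective_iff_injective_and_card y).2 ⟨hy, hcard⟩
      have hxy : y = x ∘ ((Equiv.ofBijective y hby).trans (Equiv.ofBijective x hbx).symm) := by
        funext i
        exact ((Equiv.ofBijective x hbx).apply_symm_apply (y i)).symm
      rw [hxy]
      exact (hS.2 n hn).2.1 x x 1 _ ((hS.2 n hn).2.2.1 x hx)
    · simp at h
    · rwa [some_comp_inj hx', some_comp_inj hy']
  · intro h
    obtain ⟨hx, hy⟩ := (hS.2 n hn).1 x y h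
    exact ⟨(Option.some_injective _).comp hx, (Option.some_injective _).comp hy,
      .inr (.inr ⟨hn, x, y, rfl, rfl, h⟩)⟩

/-- Over every finite substructure there is a point realizing the extension `extRel`. -/
lemma exists_realization (hM : IsFraisseLimitK0 M) {S : L0.Substructure M} (hS : MemK0 S) :
    ∃ c : M, ∀ (n : ℕ) (hn : 3 ≤ n) (x y : Fin n → Option S),
      ERel n hn (fun i => (x i).elim c (↑)) (fun i => (y i).elim c (↑)) ↔ extRel S n x y := by
  have := hS.1
  let _ := L0.structureOfRel (extRel S)
  obtain ⟨-, ⟨g⟩⟩ := (hM.2.2 (CategoryTheory.Bundled.of (Option S))).2 (memK0_ext hS)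
  change Option S ↪[L0] M at g
  let ι : S ↪[L0] Option S := L0.embeddingOfERel ⟨some, Option.some_injective S⟩
    fun n hn x y => (L0.eRel_structureOfRel _ _ _ _ _).trans (extRel_some_iff hS hn x y)
  obtain ⟨h, hh⟩ := hM.2.1 S (Substructure.FG.of_finite) (g.comp ι)
  have key : ∀ o : Option S, h (o.elim (h.symm (g none)) (↑)) = g o := by
    rintro (_ | s)
    · simp
    · exact (DFunLike.congr_fun hh s).symm
  refine ⟨h.symm (g none), fun n hn x y => ?_⟩
  rw [← L0.eRel_structureOfRel (extRel S) n hn, ← L0.eRel_map g hn,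
    ← L0.eRel_map h.toEmbedding hn]
  have (x : Fin n → Option S) :
      h.toEmbedding ∘ (fun i => (x i).elim (h.symm (g none)) (↑)) = g ∘ x :=
    funext fun i => key (x i)
  rw [this, this]

end IsFraisseLimitK0

/-- A Fraïssé limit `M` of `K₀` has no AZ-enumeration: there is no
linear order `≺` on `M` of order type `ω` (encoded by an order isomorphism with `ℕ`)
such that for every `n ≥ 1` and every sequence of `n`-tuples `(b̄ᵢ)` from `M` there are
`i < j` and a `≺`-preserving elementary embedding `f : M → M` with `f(b̄ᵢ) = b̄ⱼ`. -/
theorem fraisse_limit_no_AZ_enumeration (M : Type) [L0.Structure M]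
    (hM : IsFraisseLimitK0 M) :
    ¬ ∃ (r : M → M → Prop) (e : M ≃ ℕ), (∀ x y, r x y ↔ e x < e y) ∧
      ∀ n : ℕ, 1 ≤ n → ∀ b : ℕ → (Fin n → M),
        ∃ i j : ℕ, i < j ∧ ∃ f : M ↪ₑ[L0] M,
          (∀ x y, r x y → r (f x) (f y)) ∧ (f ∘ b i = b j) := by
  rintro ⟨r, e, hr, H⟩
  choose S hS hK using fun k : ℕ => hM.exists_memK0_substructure
    ((Set.finite_Iio k).preimage e.injective.injOn)
  have hmem (k : ℕ) (m : M) : m ∈ S k ↔ e m < k := by simp [← SetLike.mem_coe, hS]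
  choose c hc using fun k => hM.exists_realization (hK k)
  obtain ⟨i, j, hij, f, hf, hb⟩ := H 2 (by norm_num) fun k => ![e.symm (k + 3), c (k + 3)]
  have ha : f (e.symm (i + 3)) = e.symm (j + 3) := congrFun hb 0
  have hcij : f (c (i + 3)) = c (j + 3) := congrFun hb 1
  let F (s : S (i + 3)) : S (j + 3) := ⟨f s, by
    have h := (hr _ _).1 (hf s (e.symm (i + 3)) ((hr _ _).2 (by simpa using (hmem _ _).1 s.2)))
    rw [ha] at h
    exact (hmem _ _).2 (by simpa using h)⟩
  have hF (o : Option (S (i + 3))) :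
      f (o.elim (c (i + 3)) (↑)) = (o.map F).elim (c (j + 3)) (↑) := by
    cases o with
    | none => exact hcij
    | some s => rfl
  have hcard (k : ℕ) : Nat.card (S k) = k := by
    have hequiv : S k ≃ Fin k :=
      (e.subtypeEquiv fun m => hmem k m).trans Fin.equivSubtype.symm
    simpa using Nat.card_congr hequiv
  let s (t : Fin (i + 3)) : S (i + 3) := ⟨e.symm t, (hmem _ _).2 (by simp)⟩
  have hs : Function.Injective s := fun t u h =>
    Fin.ext (e.symm.injective (congrArg Subtype.val h))
  let p : Fin (i + 3) → Option (S (i + 3)) := some ∘ s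
  let q : Fin (i + 3) → Option (S (i + 3)) := fun t => if t = 0 then none else some (s t)
  have hp : Function.Injective p := (Option.some_injective _).comp hs
  have hq : Function.Injective q := by
    intro t u h
    by_cases ht : t = 0 <;> by_cases hu : u = 0 <;> simp_all [q, hs.eq_iff]
  have hpq := (hc (i + 3) (i + 3) (by omega) q p).2 ⟨hq, hp, .inl (hcard _).le⟩
  rw [← L0.eRel_map f.toEmbedding] at hpq
  have hmap (x : Fin (i + 3) → Option (S (i + 3))) :
      f.toEmbedding ∘ (fun t => (x t).elim (c (i + 3)) (↑)) =
        fun t => ((x t).map F).elim (c (j + 3)) (↑) := funext fun t => hF (x t)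
  rw [hmap, hmap] at hpq
  obtain ⟨-, -, h | ⟨-, t, ht⟩ | ⟨-, q', -, hq', -⟩⟩ :=
    (hc (j + 3) (i + 3) (by omega) (fun t => (q t).map F) (fun t => (p t).map F)).1 hpq
  · rw [hcard] at h
    omega
  · simp [p] at ht
  · simpa [q] using congrFun hq' 0
end
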